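/- arXiv:2307.10329 — 3 statements merged into one kernel-verified Lean document; each statement's English description precedes it below -/
import Mathlib

section
/- There exists a smooth function ϱ : ℝ → ℝ with 0 ≤ ϱ(x) ≤ 1 for all x, with ϱ compactly supported in (−1/2, 1/2), and such that its Fourier transform satisfies ϱ̂(x) > 0 for every x ∈ ℝ. -/
open Complex Real MeasureTheory

open scoped FourierTransform Convolution

/-- The Fourier transform of an even real-valued function is real-valued. -/
lemma fourier_ofReal_eq_re_of_even {f : ℝ → ℝ} (hf : ∀ x, f (-x) = f x) (ξ : ℝ) :
    𝓕 (fun x ↦ (f x : ℂ)) ξ = ((𝓕 (fun x ↦ (f x : ℂ)) ξ).re : ℂ) := by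
  rw [eq_comm, ← Complex.conj_eq_iff_re, Real.fourier_real_eq_integral_exp_smul, ← integral_conj,
    ← integral_neg_eq_self]
  congr 1 with x
  simp only [smul_eq_mul, map_mul, ← Complex.exp_conj, Complex.conj_ofReal, Complex.conj_I, hf]
  congr 2
  push_cast
  ring

/-- Multiplying an integrable `g` by a Gaussian averages its Fourier transform against a Gaussian. -/
lemma integral_gaussian_mul_exp {g : ℝ → ℂ} (hg : Integrable g) (u : ℝ) :
    ∫ x : ℝ, (rexp (-π * x ^ 2) * g x) * cexp (-(2 * π * Complex.I * x * u)) =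
      rexp (-π * u ^ 2) * ∫ ξ : ℝ, 𝓕 g ξ * rexp (-π * ξ ^ 2 + 2 * π * u * ξ) := by
  have hgauss : Integrable (fun ξ : ℝ ↦ cexp (-π * 1 * ξ ^ 2 + 2 * π * u * ξ)) := by
    simpa using integrable_cexp_quadratic (b := (π : ℂ)) (by simpa using pi_pos) (2 * π * u) 0
  have hself := VectorFourier.integral_fourierIntegral_smul_eq_flip (μ := volume) (ν := volume)
    (L := innerₗ ℝ) continuous_fourierChar continuous_inner hg hgauss
  rw [flip_innerₗ] at hself
  change ∫ ξ, 𝓕 g ξ • _ = ∫ x, g x • 𝓕 (fun ξ : ℝ ↦ cexp (-π * 1 * ξ ^ 2 + 2 * π * u * ξ)) x at hself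
  rw [fourier_gaussian_pi' (by simp)] at hself
  have hleft : ∫ ξ : ℝ, 𝓕 g ξ * rexp (-π * ξ ^ 2 + 2 * π * u * ξ) =
      ∫ ξ : ℝ, 𝓕 g ξ • cexp (-π * 1 * ξ ^ 2 + 2 * π * u * ξ) := by
    congr 1 with ξ
    simp
  rw [hleft, hself, ← integral_const_mul]
  congr 1 with x
  have hexp : cexp (-π * x ^ 2) * cexp (-(2 * π * Complex.I * x * u)) =
      cexp (-π * u ^ 2) * cexp (-π / 1 * (x + Complex.I * u) ^ 2) := by
    rw [← Complex.exp_add, ← Complex.exp_add]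
    congr 1
    linear_combination (π * u ^ 2 : ℂ) * Complex.I_sq
  push_cast
  simp only [one_cpow, div_one, one_mul, smul_eq_mul] at hexp ⊢
  linear_combination (g x) * hexp

/-- If `g` is integrable with Fourier transform the square of a real function that is nonzero
somewhere, then the product of `g` with a Gaussian has positive Fourier transform. -/
lemma fourier_gaussian_mul_pos {g : ℝ → ℂ} {F : ℝ → ℝ} (hg : Integrable g)
    (hF : Continuous F) (hgF : ∀ ξ, 𝓕 g ξ = (F ξ : ℂ) ^ 2) {ξ₀ : ℝ} (hξ₀ : F ξ₀ ≠ 0) (u : ℝ) :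
    ∃ r : ℝ, 0 < r ∧
      ∫ x : ℝ, (rexp (-π * x ^ 2) * g x) * cexp (-(2 * π * Complex.I * x * u)) = r := by
  have hgauss : Integrable (fun ξ : ℝ ↦ rexp (-π * ξ ^ 2 + 2 * π * u * ξ)) := by
    have h := (integrable_cexp_quadratic (b := (π : ℂ)) (by simpa using pi_pos)
      (2 * π * u) 0).norm
    refine h.congr (.of_forall fun ξ ↦ ?_)
    have : -(π : ℂ) * ξ ^ 2 + 2 * π * u * ξ + 0 =
      ((-π * ξ ^ 2 + 2 * π * u * ξ : ℝ) : ℂ) := by push_cast; ring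
    simp only [this, Complex.norm_exp_ofReal]
  have hint : Integrable (fun ξ : ℝ ↦ F ξ ^ 2 * rexp (-π * ξ ^ 2 + 2 * π * u * ξ)) := by
    refine hgauss.bdd_mul (c := ∫ x, ‖g x‖) (by fun_prop) (.of_forall fun ξ ↦ ?_)
    have h := VectorFourier.norm_fourierIntegral_le_integral_norm 𝐞 volume (innerₗ ℝ) g ξ
    change ‖𝓕 g ξ‖ ≤ _ at h
    rw [hgF] at h
    simpa using h
  refine ⟨rexp (-π * u ^ 2) * ∫ ξ : ℝ, F ξ ^ 2 * rexp (-π * ξ ^ 2 + 2 * π * u * ξ),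
    mul_pos (exp_pos _) (integral_pos_of_integrable_nonneg_nonzero (x := ξ₀) (by fun_prop) hint
      (fun ξ ↦ by positivity) (by positivity)), ?_⟩
  rw [integral_gaussian_mul_exp hg, Complex.ofReal_mul, ← integral_complex_ofReal]
  simp only [hgF]
  push_cast
  rfl

/-- There exists a smooth `ϱ : ℝ → ℝ` with `0 ≤ ϱ ≤ 1`, compactly supported in
`(-1/2, 1/2)`, whose Fourier transform `ϱ̂(u) = ∫ ϱ(x) e(-xu) dx` is a strictly positive
real number for every `u ∈ ℝ`. -/
theorem exists_smooth_bump_with_positive_fourier_transform :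
    ∃ ϱ : ℝ → ℝ, ContDiff ℝ (⊤ : ℕ∞) ϱ ∧ (∀ x, 0 ≤ ϱ x ∧ ϱ x ≤ 1) ∧
      tsupport ϱ ⊆ Set.Ioo (-(1 / 2)) (1 / 2) ∧
      ∀ u : ℝ,
        (∫ x : ℝ, (ϱ x : ℂ) * Complex.exp (-(2 * π * Complex.I * x * u))).im = 0 ∧
        0 < (∫ x : ℝ, (ϱ x : ℂ) * Complex.exp (-(2 * π * Complex.I * x * u))).re := by
  let φ : ContDiffBump (0 : ℝ) := ⟨1 / 10, 1 / 5, by norm_num, by norm_num⟩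
  let g : ℝ → ℝ := φ ⋆[ContinuousLinearMap.mul ℝ ℝ] φ
  have hg_apply (x : ℝ) : g x = ∫ t, φ t * φ (x - t) := rfl
  have hg_smooth : ContDiff ℝ (⊤ : ℕ∞) g :=
    φ.hasCompactSupport.contDiff_convolution_left _ φ.contDiff φ.integrable.locallyIntegrable
  have hg_nonneg (x : ℝ) : 0 ≤ g x :=
    integral_nonneg fun t ↦ mul_nonneg φ.nonneg φ.nonneg
  have hg_le_one (x : ℝ) : g x ≤ 1 := by
    calc g x ≤ ∫ t, φ t :=
          integral_mono_of_nonneg (.of_forall fun t ↦ mul_nonneg φ.nonneg φ.nonneg) φ.integrable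
            (.of_forall fun t ↦ mul_le_of_le_one_right φ.nonneg φ.le_one)
      _ ≤ volume.real (Metric.closedBall (0 : ℝ) φ.rOut) :=
          φ.integral_le_measure_closedBall volume
      _ ≤ 1 := by
          rw [Real.volume_real_closedBall φ.rOut_pos.le]
          norm_num [φ]
  have hg_tsupport : tsupport g ⊆ Metric.closedBall 0 (2 / 5) := by
    refine closure_minimal ((support_convolution_subset _).trans ?_) Metric.isClosed_closedBall
    rintro _ ⟨a, ha, b, hb, rfl⟩
    rw [φ.support_eq, mem_ball_zero_iff, show φ.rOut = 1 / 5 from rfl] at ha hb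
    rw [mem_closedBall_zero_iff]
    exact (norm_add_le a b).trans (by linarith)
  have hg_compact : HasCompactSupport g :=
    (isCompact_closedBall (0 : ℝ) (2 / 5)).of_isClosed_subset (isClosed_tsupport g) hg_tsupport
  have hφ_int : Integrable (fun x ↦ (φ x : ℂ)) := φ.integrable.ofReal
  have hg_int : Integrable (fun x ↦ (g x : ℂ)) :=
    (hg_smooth.continuous.integrable_of_hasCompactSupport hg_compact).ofReal
  let F : ℝ → ℝ := fun ξ ↦ (𝓕 (fun x ↦ (φ x : ℂ)) ξ).re
  have hF_cont : Continuous F :=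
    Complex.continuous_re.comp (VectorFourier.fourierIntegral_continuous (L := innerₗ ℝ)
      continuous_fourierChar continuous_inner hφ_int)
  have hgF (ξ : ℝ) : 𝓕 (fun x ↦ (g x : ℂ)) ξ = (F ξ : ℂ) ^ 2 := by
    have hconv : (fun x ↦ (g x : ℂ)) =
        (fun x ↦ (φ x : ℂ)) ⋆[ContinuousLinearMap.mul ℂ ℂ] (fun x ↦ (φ x : ℂ)) := by
      ext x
      simp [hg_apply, convolution_def, ← integral_complex_ofReal]
    rw [hconv, Real.fourier_mul_convolution_eq hφ_int hφ_int,
      fourier_ofReal_eq_re_of_even (fun x ↦ φ.neg x), sq]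
  have hF_zero : F 0 ≠ 0 := by
    have : F 0 = ∫ x, φ x := by
      simp [F, Real.fourier_real_eq, integral_complex_ofReal]
    exact this ▸ φ.integral_pos.ne'
  refine ⟨fun x ↦ rexp (-π * x ^ 2) * g x, by fun_prop, fun x ↦ ⟨?_, ?_⟩, ?_, fun u ↦ ?_⟩
  · exact mul_nonneg (exp_pos _).le (hg_nonneg x)
  · exact mul_le_one₀ (Real.exp_le_one_iff.2 (by nlinarith [pi_pos, sq_nonneg x]))
      (hg_nonneg x) (hg_le_one x)
  · refine (tsupport_mul_subset_right.trans hg_tsupport).trans fun x hx ↦ ?_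
    rw [Real.closedBall_eq_Icc] at hx
    constructor <;> linarith [hx.1, hx.2]
  · obtain ⟨r, hr, h⟩ := fourier_gaussian_mul_pos hg_int hF_cont hgF hF_zero u
    simp only [Complex.ofReal_mul, h]
    exact ⟨Complex.ofReal_im r, hr⟩
end

section
/- Let β, γ be real numbers with β < 2, let A ≥ 1 be an integer, and let x > 1 be real. Then (1/2πi) ∫_{Re s = 2} [(s + iγ − 1)/(s − β)] · ((1 − e^{−(s−β)})/(s − β))^{2A} · x^{−s} ds = 0. -/
open Complex Real MeasureTheory

open Set Filter Topology in
/-- A holomorphic function on a closed right half-plane that decays quadratically has vanishing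
integral along the boundary line. -/
theorem integral_vertical_line_eq_zero_of_norm_le_div_sq {f : ℂ → ℂ} {a b C : ℝ} (hba : b ≤ a)
    (hf : DifferentiableOn ℂ f {z | a ≤ z.re})
    (hC : ∀ z : ℂ, a ≤ z.re → ‖f z‖ ≤ C / ‖z - b‖ ^ 2) :
    ∫ τ : ℝ, f (a + τ * Complex.I) = 0 := by
  by_cases hint : Integrable fun τ : ℝ ↦ f (a + τ * Complex.I)
  swap
  · exact integral_undef hint
  have hlim := intervalIntegral_tendsto_integral hint tendsto_neg_atTop_atBot tendsto_id
  refine tendsto_nhds_unique hlim ?_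
  have hdecay : Tendsto (fun R : ℝ ↦ 4 * |C| / R) atTop (𝓝 0) :=
    tendsto_const_nhds.div_atTop tendsto_id
  refine squeeze_zero_norm' ?_ hdecay
  filter_upwards [eventually_gt_atTop 0] with R hR
  have hbound : ∀ z : ℂ, a ≤ z.re → R ≤ ‖z - b‖ → ‖f z‖ ≤ |C| / R ^ 2 := fun z hz hRz ↦
    calc
      ‖f z‖ ≤ C / ‖z - b‖ ^ 2 := hC z hz
      _ ≤ |C| / ‖z - b‖ ^ 2 := by gcongr; exact le_abs_self C
      _ ≤ |C| / R ^ 2 := by gcongr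
  have hhor : ∀ t : ℝ, |t| = R →
      ‖∫ u in a..(a + R), f (u + t * Complex.I)‖ ≤ |C| / R ^ 2 * R := by
    intro t ht
    have h := intervalIntegral.norm_integral_le_of_norm_le_const (a := a) (b := a + R)
      (f := fun u : ℝ ↦ f (u + t * Complex.I)) (C := |C| / R ^ 2) (by
        intro u hu
        rw [uIoc_of_le (by linarith)] at hu
        refine hbound _ (by simpa using hu.1.le) ?_
        rw [← ht]
        simpa using abs_im_le_norm ((u : ℂ) + t * Complex.I - b))
    rwa [add_sub_cancel_left, abs_of_pos hR] at h
  have hver : ‖∫ τ in (-R)..R, f ((a + R : ℝ) + τ * Complex.I)‖ ≤ |C| / R ^ 2 * (2 * R) := by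
    have h := intervalIntegral.norm_integral_le_of_norm_le_const (a := -R) (b := R)
      (f := fun τ : ℝ ↦ f ((a + R : ℝ) + τ * Complex.I)) (C := |C| / R ^ 2) (by
        intro τ _
        refine hbound _ (by simpa using hR.le) ?_
        have h := re_le_norm (((a + R : ℝ) : ℂ) + τ * Complex.I - b)
        simp only [sub_re, add_re, ofReal_re, re_ofReal_mul, I_re, mul_zero, add_zero] at h
        linarith)
    rwa [sub_neg_eq_add, ← two_mul, abs_of_pos (by positivity : 0 < 2 * R)] at h
  have hrect := integral_boundary_rect_eq_zero_of_differentiableOn f ⟨a, -R⟩ ⟨a + R, R⟩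
    (hf.mono fun z hz ↦ by
      have h := hz.1
      simp only [mem_preimage] at h
      rw [uIcc_of_le (by linarith)] at h
      exact h.1)
  simp only [smul_eq_mul] at hrect
  have hb := hhor (-R) (by rw [abs_neg, abs_of_pos hR])
  have ht := hhor R (abs_of_pos hR)
  have hleft : Complex.I * ∫ τ in (-R)..R, f (a + τ * Complex.I) =
      (∫ u in a..(a + R), f (u + (-R : ℝ) * Complex.I)) -
        (∫ u in a..(a + R), f (u + R * Complex.I)) +
        Complex.I * ∫ τ in (-R)..R, f ((a + R : ℝ) + τ * Complex.I) := by
    linear_combination -hrect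
  calc
    ‖∫ τ in (-R)..R, f (a + τ * Complex.I)‖
        = ‖Complex.I * ∫ τ in (-R)..R, f (a + τ * Complex.I)‖ := by simp
    _ ≤ |C| / R ^ 2 * R + |C| / R ^ 2 * R + |C| / R ^ 2 * (2 * R) := by
      rw [hleft]
      refine (norm_add_le _ _).trans (add_le_add ((norm_sub_le _ _).trans (add_le_add hb ht)) ?_)
      simpa using hver
    _ = 4 * |C| / R := by field_simp; ring

theorem norm_one_sub_exp_neg_le_two {w : ℂ} (hw : 0 ≤ w.re) : ‖1 - Complex.exp (-w)‖ ≤ 2 := by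
  have h : ‖Complex.exp (-w)‖ ≤ 1 := by
    rw [Complex.norm_exp, neg_re, Real.exp_le_one_iff]
    linarith
  calc
    ‖1 - Complex.exp (-w)‖ ≤ ‖(1 : ℂ)‖ + ‖Complex.exp (-w)‖ := norm_sub_le _ _
    _ ≤ 2 := by rw [norm_one]; linarith

/-- For `β < 2`, an integer `A ≥ 1` and real `x > 1`, the contour integral over `Re s = 2`
`(1/2πi) ∫ (s + iγ - 1)/(s - β) · ((1 - e^{-(s-β)})/(s-β))^{2A} · x^{-s} ds` vanishes.
(The contour integral is written as `(1/2π) ∫_ℝ F(2 + iτ) dτ`.) -/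
theorem contour_integral_vanishes_for_x_gt_one
    (β γ : ℝ) (hβ : β < 2) (A : ℕ) (hA : 1 ≤ A) (x : ℝ) (hx : 1 < x) :
    (1 / (2 * (π : ℂ))) * ∫ τ : ℝ,
        ((2 + (τ : ℂ) * Complex.I) + Complex.I * (γ : ℂ) - 1) /
            ((2 + (τ : ℂ) * Complex.I) - (β : ℂ)) *
          ((1 - Complex.exp (-((2 + (τ : ℂ) * Complex.I) - (β : ℂ)))) /
              ((2 + (τ : ℂ) * Complex.I) - (β : ℂ))) ^ (2 * A) *
          (x : ℂ) ^ (-(2 + (τ : ℂ) * Complex.I)) = 0 := by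
  have hx0 : 0 < x := one_pos.trans hx
  have hd : 0 < 2 - β := by linarith
  have hre : ∀ z : ℂ, 2 ≤ z.re → 2 - β ≤ (z - β).re := fun z hz ↦ by
    rw [sub_re, ofReal_re]
    linarith
  have hne : ∀ z : ℂ, 2 ≤ z.re → z - β ≠ 0 := fun z hz h ↦ by
    have := hre z hz
    rw [h, zero_re] at this
    linarith
  set c : ℂ := β + Complex.I * γ - 1 with hc
  have key := integral_vertical_line_eq_zero_of_norm_le_div_sq (a := 2) (b := β)
    (f := fun s : ℂ ↦ (s + Complex.I * γ - 1) / (s - β) *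
      ((1 - Complex.exp (-(s - β))) / (s - β)) ^ (2 * A) * (x : ℂ) ^ (-s))
    (C := (1 + ‖c‖ / (2 - β)) * (4 * (4 / (2 - β) ^ 2) ^ (A - 1))) hβ.le ?_ ?_
  · rw [ofReal_ofNat] at key
    rw [key, mul_zero]
  · intro z hz
    have hz' := hne z hz
    have hxz : (x : ℂ) ≠ 0 := ofReal_ne_zero.mpr hx0.ne'
    refine DifferentiableAt.differentiableWithinAt ?_
    refine DifferentiableAt.mul (by fun_prop (disch := assumption)) ?_
    exact differentiableAt_id.neg.const_cpow (Or.inl hxz)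
  · intro z hz
    set w : ℂ := z - β with hw
    have hdw : 2 - β ≤ ‖w‖ := (hre z hz).trans (re_le_norm w)
    have hw0 : 0 < ‖w‖ := hd.trans_le hdw
    have h1 : ‖(z + Complex.I * γ - 1) / w‖ ≤ 1 + ‖c‖ / (2 - β) := by
      have : (z + Complex.I * γ - 1) / w = 1 + c / w := by
        rw [one_add_div (hne z hz)]
        congr 1
        rw [hc]
        ring
      rw [this]
      refine (norm_add_le _ _).trans ?_
      rw [norm_one, norm_div]
      gcongr
    have h2 : ‖((1 - Complex.exp (-w)) / w) ^ (2 * A)‖ ≤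
        4 * (4 / (2 - β) ^ 2) ^ (A - 1) / ‖w‖ ^ 2 := by
      have hnum := norm_one_sub_exp_neg_le_two (hd.le.trans (hre z hz))
      calc
        ‖((1 - Complex.exp (-w)) / w) ^ (2 * A)‖
            = (‖1 - Complex.exp (-w)‖ / ‖w‖) ^ (2 * A) := by rw [norm_pow, norm_div]
        _ ≤ (2 / ‖w‖) ^ (2 * A) := by gcongr
        _ = (4 / ‖w‖ ^ 2) ^ (A - 1) * (4 / ‖w‖ ^ 2) := by
          rw [← pow_succ, Nat.sub_add_cancel hA, pow_mul, div_pow]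
          norm_num
        _ ≤ (4 / (2 - β) ^ 2) ^ (A - 1) * (4 / ‖w‖ ^ 2) := by gcongr
        _ = 4 * (4 / (2 - β) ^ 2) ^ (A - 1) / ‖w‖ ^ 2 := by ring
    have h3 : ‖(x : ℂ) ^ (-z)‖ ≤ 1 := by
      rw [norm_cpow_eq_rpow_re_of_pos hx0]
      refine Real.rpow_le_one_of_one_le_of_nonpos hx.le ?_
      rw [neg_re]
      linarith
    calc
      ‖(z + Complex.I * γ - 1) / w * ((1 - Complex.exp (-w)) / w) ^ (2 * A) * (x : ℂ) ^ (-z)‖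
          ≤ (1 + ‖c‖ / (2 - β)) * (4 * (4 / (2 - β) ^ 2) ^ (A - 1) / ‖w‖ ^ 2) * 1 := by
        rw [norm_mul, norm_mul]
        gcongr
      _ = (1 + ‖c‖ / (2 - β)) * (4 * (4 / (2 - β) ^ 2) ^ (A - 1)) / ‖w‖ ^ 2 := by ring
end

section
/- Let χ be a primitive Dirichlet character. Then the Dirichlet L-function L(s, χ) has a zero ρ with 1/2 ≤ Re ρ < 1. -/
open Complex

theorem Complex.iteratedDeriv_two_eq_zero_of_norm_le_rpow {g : ℂ → ℂ} (hg : Differentiable ℂ g)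
    {C : ℝ} (hC : ∀ z, ‖g z‖ ≤ C * (1 + ‖z‖) ^ (3 / 2 : ℝ)) (c : ℂ) :
    iteratedDeriv 2 g c = 0 := by
  have hC0 : 0 ≤ C := by simpa using (norm_nonneg _).trans (hC 0)
  have key : ∀ R : ℝ, 1 + ‖c‖ ≤ R →
      ‖iteratedDeriv 2 g c‖ ≤ 2 * C * 2 ^ (3 / 2 : ℝ) * R ^ (-(1 / 2) : ℝ) := by
    intro R hR
    have hR0 : 0 < R := by linarith [norm_nonneg c]
    have h := norm_iteratedDeriv_le_of_forall_mem_sphere_norm_le (f := g) (c := c)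
      (C := C * (2 * R) ^ (3 / 2 : ℝ)) 2 hR0 hg.diffContOnCl fun z hz ↦ by
        refine (hC z).trans ?_
        have : ‖z‖ ≤ ‖c‖ + R := by
          have h1 : ‖z - c‖ = R := by simpa using hz
          have h2 := norm_le_insert' z c
          linarith
        gcongr
        linarith
    refine h.trans_eq ?_
    rw [Real.mul_rpow (by norm_num) hR0.le, show (-(1 / 2) : ℝ) = 3 / 2 - (2 : ℕ) by norm_num,
      Real.rpow_sub_natCast hR0.ne']
    norm_num
    ring
  have lim : Filter.Tendsto (fun R : ℝ ↦ 2 * C * 2 ^ (3 / 2 : ℝ) * R ^ (-(1 / 2) : ℝ))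
      Filter.atTop (nhds 0) := by
    simpa using (tendsto_rpow_neg_atTop (by norm_num : (0 : ℝ) < 1 / 2)).const_mul
      (2 * C * 2 ^ (3 / 2 : ℝ))
  exact norm_le_zero_iff.mp <| ge_of_tendsto lim <|
    (Filter.eventually_ge_atTop (1 + ‖c‖)).mono key

theorem Complex.exists_eq_mul_exp_of_norm_le_exp_rpow {f : ℂ → ℂ} (hf : Differentiable ℂ f)
    (hf0 : ∀ z, f z ≠ 0) {C : ℝ} (hC : ∀ z, ‖f z‖ ≤ Real.exp (C * (1 + ‖z‖) ^ (3 / 2 : ℝ))) :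
    ∃ k : ℂ, ∀ z, f z = f 0 * exp (k * z) := by
  obtain ⟨g, hg0, hg⟩ := (hf.deriv.div hf hf0).isExactOn_univ.with_val_at 0 0
  replace hg : ∀ z, HasDerivAt g (deriv f z / f z) z := fun z ↦ hg z (Set.mem_univ z)
  have hgd : Differentiable ℂ g := fun z ↦ (hg z).differentiableAt
  have hfg : ∀ z, f z = f 0 * exp (g z) := by
    intro z
    have hd : ∀ w, HasDerivAt (fun w ↦ f w * exp (-g w)) 0 w := fun w ↦ by
      refine ((hf w).hasDerivAt.mul (hg w).neg.cexp).congr_deriv ?_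
      field_simp [hf0 w]
      ring
    have h := is_const_of_deriv_eq_zero (fun w ↦ (hd w).differentiableAt)
      (fun w ↦ (hd w).deriv) z 0
    simp only [hg0, neg_zero, exp_zero, mul_one] at h
    rw [← h, mul_assoc, ← exp_add, neg_add_cancel, exp_zero, mul_one]
  set D : ℝ := |C| + |Real.log ‖f 0‖| + 1 with hD
  have hD0 : 0 < D := by positivity
  have hre : ∀ z, (g z).re ≤ D * (1 + ‖z‖) ^ (3 / 2 : ℝ) := by
    intro z
    have h1 := hC z
    rw [hfg z, norm_mul, norm_exp, ← Real.exp_log (norm_pos_iff.mpr (hf0 0)), ← Real.exp_add,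
      Real.exp_le_exp] at h1
    have h2 : (1 : ℝ) ≤ (1 + ‖z‖) ^ (3 / 2 : ℝ) :=
      Real.one_le_rpow (by linarith [norm_nonneg z]) (by norm_num)
    have h3 := neg_abs_le (Real.log ‖f 0‖)
    have h4 := le_abs_self C
    have h5 := abs_nonneg (Real.log ‖f 0‖)
    rw [hD]
    nlinarith
  have hnorm : ∀ z, ‖g z‖ ≤ 2 * D * 2 ^ (3 / 2 : ℝ) * (1 + ‖z‖) ^ (3 / 2 : ℝ) := by
    intro z
    have hz := norm_nonneg z
    have h := borelCaratheodory_zero (f := g) (z := z) (R := 2 * ‖z‖ + 1)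
      (M := D * (2 * (1 + ‖z‖)) ^ (3 / 2 : ℝ))
      (by positivity) hgd.differentiableOn (fun w hw ↦ by
        have : ‖w‖ < 2 * ‖z‖ + 1 := by simpa using hw
        refine (hre w).trans ?_
        gcongr
        linarith) (by linarith) (by simp; linarith) hg0
    rw [Real.mul_rpow (by norm_num) (by positivity)] at h
    refine h.trans ?_
    rw [div_le_iff₀ (by linarith)]
    have : 0 ≤ D * (2 ^ (3 / 2 : ℝ) * (1 + ‖z‖) ^ (3 / 2 : ℝ)) := by positivity
    nlinarith
  have h2 := iteratedDeriv_two_eq_zero_of_norm_le_rpow hgd hnorm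
  simp only [iteratedDeriv_succ, iteratedDeriv_zero] at h2
  have hconst : ∀ z, deriv g z = deriv g 0 := fun z ↦
    is_const_of_deriv_eq_zero hgd.deriv h2 z 0
  refine ⟨deriv g 0, fun z ↦ ?_⟩
  have hd : ∀ w, HasDerivAt (fun w ↦ g w - deriv g 0 * w) 0 w := fun w ↦ by
    refine ((hgd w).hasDerivAt.sub ((hasDerivAt_id w).const_mul _)).congr_deriv ?_
    rw [hconst w]
    ring
  have h := is_const_of_deriv_eq_zero (fun w ↦ (hd w).differentiableAt)
      (fun w ↦ (hd w).deriv) z 0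
  simp only [hg0, mul_zero, sub_zero, sub_eq_zero] at h
  rw [hfg z, h]

theorem Real.Gamma_le_exp_rpow {x : ℝ} (hx : 1 ≤ x) :
    Real.Gamma x ≤ Real.exp (2 * (1 + x) ^ (3 / 2 : ℝ)) := by
  have hx0 : 0 < x := by linarith
  have h1 : Real.Gamma x ≤ Real.Gamma (x + 1) := by
    rw [Real.Gamma_add_one hx0.ne']
    exact le_mul_of_one_le_left (Real.Gamma_nonneg_of_nonneg hx0.le) hx
  have h2 : Real.Gamma (x + 1) ≤ Real.Gamma ((⌊x⌋₊ + 1 : ℕ) + 1) := by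
    have := (Nat.lt_floor_add_one x).le
    refine Real.Gamma_strictMonoOn_Ici.monotoneOn ?_ ?_ ?_
    · simp; linarith
    · simp; linarith
    · push_cast; linarith
  rw [Real.Gamma_nat_eq_factorial] at h2
  have h3 : ((Nat.factorial (⌊x⌋₊ + 1) : ℕ) : ℝ) ≤ (1 + x) ^ (⌊x⌋₊ + 1) := by
    calc ((Nat.factorial (⌊x⌋₊ + 1) : ℕ) : ℝ) ≤ ((⌊x⌋₊ + 1 : ℕ) : ℝ) ^ (⌊x⌋₊ + 1) := by
          exact_mod_cast Nat.factorial_le_pow _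
      _ ≤ _ := by
          gcongr
          push_cast
          linarith [Nat.floor_le hx0.le]
  have h4 : (1 + x) ^ (⌊x⌋₊ + 1) ≤ (1 + x) ^ (1 + x) := by
    rw [← Real.rpow_natCast]
    refine Real.rpow_le_rpow_of_exponent_le (by linarith) ?_
    push_cast
    linarith [Nat.floor_le hx0.le]
  have h5 : (1 + x) ^ (1 + x) ≤ Real.exp (2 * (1 + x) ^ (3 / 2 : ℝ)) := by
    rw [Real.rpow_def_of_pos (by linarith), Real.exp_le_exp]
    have h6 := Real.log_le_rpow_div (x := 1 + x) (by linarith) (by norm_num : (0 : ℝ) < 1 / 2)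
    have h7 : (1 + x) ^ (3 / 2 : ℝ) = (1 + x) ^ (1 / 2 : ℝ) * (1 + x) := by
      rw [← Real.rpow_add_one (by linarith)]
      norm_num
    rw [h7]
    nlinarith
  exact (h1.trans h2).trans (h3.trans (h4.trans h5))

theorem Complex.norm_Gamma_le {s : ℂ} (hs : 0 < s.re) : ‖Gamma s‖ ≤ Real.Gamma s.re := by
  rw [Complex.Gamma_eq_integral hs, Real.Gamma_eq_integral hs, Complex.GammaIntegral]
  refine (MeasureTheory.norm_integral_le_integral_norm _).trans_eq ?_
  refine MeasureTheory.setIntegral_congr_fun measurableSet_Ioi fun x hx ↦ ?_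
  simp [norm_cpow_eq_rpow_re_of_pos hx, Complex.norm_exp]

theorem Complex.norm_Gammaℝ_le {s : ℂ} (hs : 2 ≤ s.re) :
    ‖Gammaℝ s‖ ≤ Real.exp (2 * (1 + ‖s‖) ^ (3 / 2 : ℝ)) := by
  have hre : (s / 2).re = s.re / 2 := by simp
  rw [Gammaℝ_def, norm_mul, norm_cpow_eq_rpow_re_of_pos Real.pi_pos]
  have h1 : Real.pi ^ (-s / 2).re ≤ 1 :=
    Real.rpow_le_one_of_one_le_of_nonpos (by linarith [Real.pi_gt_three]) (by simp; linarith)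
  have h2 : ‖Gamma (s / 2)‖ ≤ Real.exp (2 * (1 + ‖s‖) ^ (3 / 2 : ℝ)) := by
    refine (norm_Gamma_le (by rw [hre]; linarith)).trans ?_
    refine (Real.Gamma_le_exp_rpow (by rw [hre]; linarith)).trans ?_
    have := re_le_norm s
    rw [hre]
    gcongr
    linarith
  exact (mul_le_of_le_one_left (norm_nonneg _) h1).trans h2

theorem WeakFEPair.exists_norm_Λ₀_le {E : Type*} [NormedAddCommGroup E] [NormedSpace ℂ E]
    (P : WeakFEPair E) (a b : ℝ) :
    ∃ C, ∀ s : ℂ, a ≤ s.re → s.re ≤ b → ‖P.Λ₀ s‖ ≤ C := by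
  have hS := P.isStrongFEPair_toStrongFEPair
  have hconv : ∀ s : ℂ, MellinConvergent P.f_modif s := fun s ↦
    let ⟨_, ht⟩ := exists_gt s.re
    let ⟨_, hu⟩ := exists_lt s.re
    mellinConvergent_of_isBigO_rpow P.hf_modif_int (hS.hf_top _) ht (hS.hf_zero _) hu
  have hint : ∀ s : ℂ, MeasureTheory.IntegrableOn
      (fun t : ℝ ↦ t ^ (s.re - 1) * ‖P.f_modif t‖) (Set.Ioi 0) := fun s ↦ by
    refine MeasureTheory.IntegrableOn.congr_fun (hconv s).norm (fun t ht ↦ ?_) measurableSet_Ioi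
    simp [norm_smul, norm_cpow_eq_rpow_re_of_pos ht]
  refine ⟨∫ t in Set.Ioi (0 : ℝ), (t ^ (a - 1) * ‖P.f_modif t‖ + t ^ (b - 1) * ‖P.f_modif t‖),
    fun s has hsb ↦ ?_⟩
  have hab := (hint a).add (hint b)
  simp only [ofReal_re] at hab
  rw [WeakFEPair.Λ₀, mellin]
  refine MeasureTheory.norm_integral_le_of_norm_le hab ?_
  filter_upwards [MeasureTheory.ae_restrict_mem measurableSet_Ioi] with t ht
  rw [norm_smul, norm_cpow_eq_rpow_re_of_pos ht, ← add_mul]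
  gcongr
  have ht0 : (0 : ℝ) < t := ht
  simp only [sub_re, one_re]
  rcases le_total t 1 with h | h
  · exact (Real.rpow_le_rpow_of_exponent_ge ht0 h (by linarith)).trans
      (le_add_of_nonneg_right (by positivity))
  · exact (Real.rpow_le_rpow_of_exponent_le h (by linarith)).trans
      (le_add_of_nonneg_left (by positivity))

open HurwitzZeta in
theorem ZMod.exists_norm_completedLFunction₀_le {N : ℕ} [NeZero N] (Φ : ZMod N → ℂ) (a b : ℝ) :
    ∃ C, ∀ s : ℂ, a ≤ s.re → s.re ≤ b → ‖ZMod.completedLFunction₀ Φ s‖ ≤ C := by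
  have hE : ∀ x : UnitAddCircle, ∃ C, ∀ s : ℂ, a ≤ s.re → s.re ≤ b →
      ‖completedHurwitzZetaEven₀ x s‖ ≤ C := fun x ↦ by
    obtain ⟨C, hC⟩ := (hurwitzEvenFEPair x).exists_norm_Λ₀_le (a / 2) (b / 2)
    refine ⟨C / 2, fun s h1 h2 ↦ ?_⟩
    rw [completedHurwitzZetaEven₀, norm_div, norm_ofNat]
    have := hC (s / 2) (by simp; linarith) (by simp; linarith)
    linarith
  have hO : ∀ x : UnitAddCircle, ∃ C, ∀ s : ℂ, a ≤ s.re → s.re ≤ b →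
      ‖completedHurwitzZetaOdd x s‖ ≤ C := fun x ↦ by
    obtain ⟨C, hC⟩ := (hurwitzOddFEPair x).exists_norm_Λ₀_le ((a + 1) / 2) ((b + 1) / 2)
    refine ⟨C / 2, fun s h1 h2 ↦ ?_⟩
    have := hC ((s + 1) / 2) (by simp; linarith) (by simp; linarith)
    rw [completedHurwitzZetaOdd, norm_div, norm_ofNat, WeakFEPair.Λ,
      (isStrong_hurwitzOddFEPair x).hf₀, (isStrong_hurwitzOddFEPair x).hg₀]
    simp only [smul_zero, sub_zero]
    linarith
  choose E hE using hE
  choose O hO using hO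
  refine ⟨(N : ℝ) ^ (-a) * ∑ j : ZMod N, ‖Φ j‖ * E (ZMod.toAddCircle j) +
    (N : ℝ) ^ (-a) * ∑ j : ZMod N, ‖Φ j‖ * O (ZMod.toAddCircle j), fun s h1 h2 ↦ ?_⟩
  have hN : ‖(N : ℂ) ^ (-s)‖ ≤ (N : ℝ) ^ (-a) := by
    rw [norm_natCast_cpow_of_pos (NeZero.pos N)]
    exact Real.rpow_le_rpow_of_exponent_le (by exact_mod_cast NeZero.one_le) (by simp; linarith)
  rw [ZMod.completedLFunction₀]
  refine (norm_add_le _ _).trans (add_le_add ?_ ?_) <;> rw [norm_mul]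
  · refine mul_le_mul hN ((norm_sum_le _ _).trans (Finset.sum_le_sum fun j _ ↦ ?_))
      (norm_nonneg _) (by positivity)
    rw [norm_mul]
    exact mul_le_mul_of_nonneg_left (hE _ s h1 h2) (norm_nonneg _)
  · refine mul_le_mul hN ((norm_sum_le _ _).trans (Finset.sum_le_sum fun j _ ↦ ?_))
      (norm_nonneg _) (by positivity)
    rw [norm_mul]
    exact mul_le_mul_of_nonneg_left (hO _ s h1 h2) (norm_nonneg _)

namespace DirichletCharacter

open scoped ComplexConjugate
open Filter Topology

variable {q : ℕ} [NeZero q]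

theorem LFunction_inv_conj (χ : DirichletCharacter ℂ q) {s : ℂ} (hs : s ≠ 1 ∨ χ ≠ 1) :
    LFunction χ⁻¹ (conj s) = conj (LFunction χ s) := by
  have hU : IsOpen {s : ℂ | s ≠ 1 ∨ χ ≠ 1} := by
    by_cases h : χ = 1
    · simpa [h] using isOpen_ne
    · simp [h]
  have hUc : IsPreconnected {s : ℂ | s ≠ 1 ∨ χ ≠ 1} := by
    by_cases h : χ = 1
    · simpa [h, Set.compl_def] using
        (isConnected_compl_singleton_of_one_lt_rank (by simp) (1 : ℂ)).isPreconnected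
    · simpa [h] using isPreconnected_univ
  have h1 : AnalyticOnNhd ℂ (LFunction χ) {s : ℂ | s ≠ 1 ∨ χ ≠ 1} :=
    DifferentiableOn.analyticOnNhd
      (fun z hz ↦ (differentiableAt_LFunction χ z hz).differentiableWithinAt) hU
  have h2 : AnalyticOnNhd ℂ (fun z ↦ conj (LFunction χ⁻¹ (conj z))) {s : ℂ | s ≠ 1 ∨ χ ≠ 1} :=
    DifferentiableOn.analyticOnNhd
      (fun z hz ↦ (differentiableAt_conj_conj_iff.mpr <|
        differentiableAt_LFunction χ⁻¹ _ (hz.imp (map_ne_one_iff _ (starRingEnd ℂ).injective).mpr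
          inv_ne_one.mpr)).differentiableWithinAt) hU
  have h3 (z : ℂ) (hz : 1 < z.re) : conj (LFunction χ⁻¹ (conj z)) = LFunction χ z := by
    rw [LFunction_eq_LSeries χ hz, LFunction_eq_LSeries χ⁻¹ (by rwa [conj_re]), LSeries,
      conj_tsum, LSeries]
    refine tsum_congr fun n ↦ ?_
    rcases eq_or_ne n 0 with rfl | hn
    · simp
    · rw [LSeries.term_of_ne_zero hn, LSeries.term_of_ne_zero hn, map_div₀,
        ← conj_cpow _ _ (by rw [natCast_arg]; positivity), conj_natCast, ← MulChar.star_apply' χ]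
      simp
  have heq := h2.eqOn_of_preconnected_of_eventuallyEq h1 hUc
    (show (2 : ℂ) ∈ _ from Or.inl (by norm_num))
    (eventuallyEq_of_mem
      ((isOpen_lt continuous_const continuous_re).mem_nhds (by norm_num)) h3) hs
  simpa using congrArg (starRingEnd ℂ) heq

theorem gammaFactor_inv_conj {q : ℕ} (χ : DirichletCharacter ℂ q) (s : ℂ) :
    gammaFactor χ⁻¹ (conj s) = conj (gammaFactor χ s) := by
  have hG (z : ℂ) : Gammaℝ (conj z) = conj (Gammaℝ z) := by
    have hp : conj ((Real.pi : ℂ) ^ (-z / 2)) = (Real.pi : ℂ) ^ conj (-z / 2) := by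
      rw [cpow_conj _ _ (by rw [arg_ofReal_of_nonneg Real.pi_pos.le]; exact Real.pi_pos.ne),
        conj_ofReal]
    have h2 : conj (2 : ℂ) = 2 := conj_ofReal 2
    rw [Gammaℝ_def, Gammaℝ_def, map_mul, ← Gamma_conj, hp, map_div₀, map_div₀, map_neg, h2]
  have hE : χ⁻¹.Even ↔ χ.Even := by
    rw [DirichletCharacter.Even, DirichletCharacter.Even, ← MulChar.star_apply']
    exact (map_eq_one_iff (starRingEnd ℂ) (starRingEnd ℂ).injective)
  by_cases h : χ.Even
  · rw [h.gammaFactor_def, (hE.mpr h).gammaFactor_def, hG]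
  · rw [(χ.even_or_odd.resolve_left h).gammaFactor_def,
      (χ⁻¹.even_or_odd.resolve_left (mt hE.mp h)).gammaFactor_def, ← hG, map_add, map_one]

theorem gammaFactor_ne_zero {q : ℕ} (χ : DirichletCharacter ℂ q) {s : ℂ} (hs : 0 < s.re) :
    gammaFactor χ s ≠ 0 := by
  unfold gammaFactor
  split_ifs
  · exact Gammaℝ_ne_zero_of_re_pos hs
  · exact Gammaℝ_ne_zero_of_re_pos (by simp; linarith)

theorem completedLFunction_eq_gammaFactor_mul (χ : DirichletCharacter ℂ q) {s : ℂ}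
    (hs : 0 < s.re) : completedLFunction χ s = gammaFactor χ s * LFunction χ s := by
  have h0 : s ≠ 0 := by rintro rfl; simp at hs
  rw [LFunction_eq_completed_div_gammaFactor χ s (.inl h0),
    mul_div_cancel₀ _ (gammaFactor_ne_zero χ hs)]

theorem completedLFunction_inv_conj (χ : DirichletCharacter ℂ q) {s : ℂ} (hs : 0 < s.re)
    (hs' : s ≠ 1 ∨ χ ≠ 1) :
    completedLFunction χ⁻¹ (conj s) = conj (completedLFunction χ s) := by
  rw [completedLFunction_eq_gammaFactor_mul _ hs,
    completedLFunction_eq_gammaFactor_mul _ (by rwa [conj_re]), LFunction_inv_conj χ hs',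
    gammaFactor_inv_conj, map_mul]

theorem completedLFunction_eq_mul_conj {χ : DirichletCharacter ℂ q} (hχ : χ.IsPrimitive) {s : ℂ}
    (hs : s.re < 1) (hs' : s ≠ 0 ∨ χ ≠ 1) :
    completedLFunction χ s =
      q ^ (1 / 2 - s) * rootNumber χ * conj (completedLFunction χ (1 - conj s)) := by
  have h1 : 1 - conj s ≠ 1 ∨ χ ≠ 1 := hs'.imp_left fun h ↦ by simpa using h
  have h := hχ.completedLFunction_one_sub (1 - s)
  rw [← completedLFunction_inv_conj χ (by simpa using hs) h1]
  simp only [map_sub, map_one, conj_conj]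
  rw [sub_sub_cancel] at h
  rw [h]
  ring_nf

theorem IsPrimitive.ne_one {χ : DirichletCharacter ℂ q} (hχ : χ.IsPrimitive) (hq : q ≠ 1) :
    χ ≠ 1 := by
  rintro rfl
  rw [isPrimitive_def, conductor_one] at hχ
  exact hq hχ.symm

/-- The factor clearing the poles of the completed L-function of a primitive character
modulo `q`. -/
noncomputable def poleFactor (q : ℕ) (s : ℂ) : ℂ := if q = 1 then s * (1 - s) else 1

theorem norm_poleFactor_le (q : ℕ) (s : ℂ) : ‖poleFactor q s‖ ≤ (1 + ‖s‖) ^ 2 := by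
  have := norm_nonneg s
  unfold poleFactor
  split_ifs
  · have h := norm_sub_le 1 s
    rw [norm_one] at h
    rw [norm_mul]
    nlinarith
  · rw [norm_one]
    nlinarith

theorem poleFactor_one_sub_conj (q : ℕ) (s : ℂ) :
    poleFactor q (1 - conj s) = conj (poleFactor q s) := by
  unfold poleFactor
  split_ifs
  · simp
    ring
  · simp

theorem poleFactor_ne_zero {q : ℕ} {s : ℂ} (hs : q ≠ 1 ∨ s ≠ 0 ∧ s ≠ 1) :
    poleFactor q s ≠ 0 := by
  unfold poleFactor
  split_ifs with h
  · simp only [h, ne_eq, not_true_eq_false, false_or] at hs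
    exact mul_ne_zero hs.1 (sub_ne_zero.mpr (Ne.symm hs.2))
  · exact one_ne_zero

theorem norm_poleFactor_le_add_two (q : ℕ) {x : ℝ} (hx : 1 ≤ x) :
    ‖poleFactor q x‖ ≤ ‖poleFactor q (x + 2)‖ := by
  unfold poleFactor
  split_ifs
  · have h1 : (x : ℂ) * (1 - x) = ((x * (1 - x) : ℝ) : ℂ) := by push_cast; rfl
    have h2 : ((x : ℂ) + 2) * (1 - (x + 2)) = (((x + 2) * (1 - (x + 2)) : ℝ) : ℂ) := by
      push_cast; rfl
    rw [h1, h2, norm_real, norm_real, Real.norm_eq_abs, Real.norm_eq_abs,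
      abs_of_nonpos (by nlinarith), abs_of_nonpos (by nlinarith)]
    nlinarith
  · rfl

theorem exists_entire_completedLFunction {χ : DirichletCharacter ℂ q} (hχ : χ.IsPrimitive) :
    ∃ F : ℂ → ℂ, Differentiable ℂ F ∧
      (∀ s, (q ≠ 1 ∨ s ≠ 0 ∧ s ≠ 1) → F s = poleFactor q s * completedLFunction χ s) ∧
      (q = 1 → F 0 ≠ 0 ∧ F 1 ≠ 0) ∧
      ∀ a b : ℝ, ∃ C, ∀ s : ℂ, a ≤ s.re → s.re ≤ b → ‖F s‖ ≤ C * (1 + ‖s‖) ^ 2 := by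
  rcases eq_or_ne q 1 with rfl | hq
  · have hχ0 : χ 0 = 1 := by rw [Subsingleton.elim (0 : ZMod 1) 1, map_one]
    refine ⟨fun s ↦ s * (1 - s) * ZMod.completedLFunction₀ χ s - 1, ?_, fun s hs ↦ ?_,
      by simp, fun a b ↦ ?_⟩
    · have := ZMod.differentiable_completedLFunction₀ χ
      fun_prop
    · simp only [ne_eq, not_true_eq_false, false_or] at hs
      have h1 : 1 - s ≠ 0 := sub_ne_zero.mpr (Ne.symm hs.2)
      have h0 := hs.1
      rw [completedLFunction, ZMod.completedLFunction_eq, poleFactor, if_pos rfl, hχ0]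
      have hsum : ∑ j : ZMod 1, χ j = 1 := by
        rw [← hχ0]
        exact Fintype.sum_unique _
      rw [hsum]
      simp only [Nat.cast_one, one_cpow, mul_one]
      field_simp
      ring
    · obtain ⟨C, hC⟩ := ZMod.exists_norm_completedLFunction₀_le χ a b
      refine ⟨C + 1, fun s h1 h2 ↦ ?_⟩
      have h3 := hC s h1 h2
      have h4 := norm_poleFactor_le 1 s
      rw [poleFactor, if_pos rfl] at h4
      have h5 := norm_nonneg s
      refine (norm_sub_le _ _).trans ?_
      rw [norm_mul, norm_one]
      have h6 := mul_le_mul h4 h3 (norm_nonneg _) (by positivity)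
      nlinarith
  · have hχ1 := hχ.ne_one hq
    refine ⟨completedLFunction χ, differentiable_completedLFunction hχ1,
      fun s _ ↦ by simp [poleFactor, hq], fun h ↦ absurd h hq, fun a b ↦ ?_⟩
    obtain ⟨C, hC⟩ := ZMod.exists_norm_completedLFunction₀_le χ a b
    refine ⟨C, fun s h1 h2 ↦ ?_⟩
    have h3 := hC s h1 h2
    rw [completedLFunction, ZMod.completedLFunction_eq, χ.map_zero' hq,
      χ.sum_eq_zero_of_ne_one hχ1]
    simp only [mul_zero, zero_div, sub_zero]
    have := norm_nonneg s
    exact h3.trans <| le_mul_of_one_le_right ((norm_nonneg _).trans h3) (by nlinarith)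

theorem exists_norm_LFunction_le (χ : DirichletCharacter ℂ q) :
    ∃ B, ∀ s : ℂ, 2 ≤ s.re → ‖LFunction χ s‖ ≤ B := by
  have hsum := (LSeriesSummable_of_one_lt_re χ (s := 2) (by norm_num)).norm
  refine ⟨∑' n, ‖LSeries.term (χ ·) 2 n‖, fun s hs ↦ ?_⟩
  rw [LFunction_eq_LSeries χ (by linarith), LSeries]
  exact tsum_of_norm_bounded hsum.hasSum
    (LSeries.norm_term_le_of_re_le_re _ (by simpa using hs))

theorem norm_gammaFactor_le {q : ℕ} (χ : DirichletCharacter ℂ q) {s : ℂ} (hs : 2 ≤ s.re) :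
    ‖gammaFactor χ s‖ ≤ Real.exp (2 * (2 + ‖s‖) ^ (3 / 2 : ℝ)) := by
  unfold gammaFactor
  split_ifs
  · refine (norm_Gammaℝ_le hs).trans ?_
    gcongr
    norm_num
  · refine (norm_Gammaℝ_le (by simp; linarith)).trans ?_
    have h := norm_add_le s 1
    rw [norm_one] at h
    have h' : 1 + ‖s + 1‖ ≤ 2 + ‖s‖ := by linarith
    gcongr

theorem exists_gammaFactor_add_two {q : ℕ} (χ : DirichletCharacter ℂ q) :
    ∃ a : ℕ, ∀ s : ℂ, 0 < s.re →
      gammaFactor χ (s + 2) = gammaFactor χ s * (s + a) / 2 / Real.pi := by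
  by_cases hE : χ.Even
  · refine ⟨0, fun s hs ↦ ?_⟩
    rw [hE.gammaFactor_def, hE.gammaFactor_def, Gammaℝ_add_two (by rintro rfl; simp at hs),
      Nat.cast_zero, add_zero]
  · have hO : χ.Odd := χ.even_or_odd.resolve_left hE
    refine ⟨1, fun s hs ↦ ?_⟩
    rw [hO.gammaFactor_def, hO.gammaFactor_def, add_right_comm, Gammaℝ_add_two, Nat.cast_one]
    intro h
    have := congrArg re h
    simp at this
    linarith

theorem tendsto_LFunction_atTop (χ : DirichletCharacter ℂ q) :
    Tendsto (fun x : ℝ ↦ LFunction χ x) atTop (𝓝 1) := by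
  have h := LSeries.tendsto_atTop (f := (χ ·)) (by
    rw [absicssaOfAbsConv_eq_one (NeZero.ne q) χ]
    exact EReal.coe_lt_top 1)
  simp only [Nat.cast_one, map_one] at h
  refine h.congr' ?_
  filter_upwards [eventually_gt_atTop 1] with x hx
  rw [LFunction_eq_LSeries χ (by simpa using hx)]

theorem completedLFunction_ne_zero {χ : DirichletCharacter ℂ q} (hχ : χ.IsPrimitive)
    (hL : ∀ s : ℂ, 1 / 2 ≤ s.re → s.re < 1 → LFunction χ s ≠ 0) {s : ℂ}
    (hs : q ≠ 1 ∨ s ≠ 0 ∧ s ≠ 1) : completedLFunction χ s ≠ 0 := by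
  have right : ∀ z : ℂ, 1 / 2 ≤ z.re → (z ≠ 1 ∨ χ ≠ 1) → completedLFunction χ z ≠ 0 := by
    intro z hz hz1
    rw [completedLFunction_eq_gammaFactor_mul χ (by linarith)]
    refine mul_ne_zero (gammaFactor_ne_zero χ (by linarith)) ?_
    rcases lt_or_ge z.re 1 with h | h
    · exact hL z hz h
    · exact LFunction_ne_zero_of_one_le_re χ hz1.symm h
  have hroot : rootNumber χ ≠ 0 := by
    intro h
    refine right 2 (by norm_num) (.inl (by norm_num)) ?_
    have h2 := hχ.completedLFunction_one_sub (-1)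
    rw [h, mul_zero, zero_mul] at h2
    rw [← h2]
    norm_num
  rcases le_or_gt (1 / 2) s.re with h | h
  · exact right s h (hs.elim (fun hq ↦ .inr (hχ.ne_one hq)) fun h ↦ .inl h.2)
  · have hs' : s ≠ 0 ∨ χ ≠ 1 := hs.elim (fun hq ↦ .inr (hχ.ne_one hq)) fun h ↦ .inl h.1
    rw [completedLFunction_eq_mul_conj hχ (by linarith) hs']
    refine mul_ne_zero (mul_ne_zero ?_ hroot) ?_
    · rw [Ne, cpow_eq_zero_iff]
      simp [NeZero.ne q]
    · rw [Ne, map_eq_zero]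
      refine right _ (by simp; linarith) (hs'.imp_left fun h ↦ by simpa using h)

theorem one_add_norm_le_rpow (s : ℂ) : 1 + ‖s‖ ≤ (1 + ‖s‖) ^ (3 / 2 : ℝ) :=
  Real.self_le_rpow_of_one_le (by linarith [norm_nonneg s]) (by norm_num)

theorem sq_le_exp_rpow (s : ℂ) :
    (1 + ‖s‖) ^ 2 ≤ Real.exp (2 * (1 + ‖s‖) ^ (3 / 2 : ℝ)) := by
  have h0 := norm_nonneg s
  calc (1 + ‖s‖) ^ 2 ≤ Real.exp (1 + ‖s‖) ^ 2 := by
        gcongr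
        linarith [Real.add_one_le_exp (1 + ‖s‖)]
    _ = Real.exp (2 * (1 + ‖s‖)) := by rw [← Real.exp_nat_mul]; norm_num
    _ ≤ _ := by gcongr; exact one_add_norm_le_rpow s

theorem le_exp_abs_rpow (a : ℝ) (s : ℂ) :
    a ≤ Real.exp (|a| * (1 + ‖s‖) ^ (3 / 2 : ℝ)) := by
  have h0 := norm_nonneg s
  have h1 := one_add_norm_le_rpow s
  have h2 : |a| ≤ |a| * (1 + ‖s‖) ^ (3 / 2 : ℝ) :=
    le_mul_of_one_le_right (abs_nonneg a) (by linarith)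
  linarith [Real.add_one_le_exp (|a| * (1 + ‖s‖) ^ (3 / 2 : ℝ)), le_abs_self a]

theorem rpow_two_add_norm_le (s : ℂ) :
    (2 + ‖s‖) ^ (3 / 2 : ℝ) ≤ 2 ^ (3 / 2 : ℝ) * (1 + ‖s‖) ^ (3 / 2 : ℝ) := by
  have h0 := norm_nonneg s
  rw [← Real.mul_rpow (by norm_num) (by positivity)]
  gcongr
  linarith

theorem exists_norm_le_exp_rpow {χ : DirichletCharacter ℂ q} (hχ : χ.IsPrimitive) {F : ℂ → ℂ}
    (hF : ∀ s, (q ≠ 1 ∨ s ≠ 0 ∧ s ≠ 1) → F s = poleFactor q s * completedLFunction χ s)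
    (hb : ∀ a b : ℝ, ∃ C, ∀ s : ℂ, a ≤ s.re → s.re ≤ b → ‖F s‖ ≤ C * (1 + ‖s‖) ^ 2) :
    ∃ C, ∀ s, ‖F s‖ ≤ Real.exp (C * (1 + ‖s‖) ^ (3 / 2 : ℝ)) := by
  obtain ⟨B, hB⟩ := exists_norm_LFunction_le χ
  obtain ⟨A, hA⟩ := hb (1 / 2) 2
  obtain ⟨D, hD0, hD⟩ : ∃ D : ℝ, 0 ≤ D ∧ ∀ s : ℂ, 1 / 2 ≤ s.re →
      ‖F s‖ ≤ Real.exp (D * (1 + ‖s‖) ^ (3 / 2 : ℝ)) := by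
    refine ⟨|A| + |B| + 2 + 2 * 2 ^ (3 / 2 : ℝ), by positivity, fun s hs ↦ ?_⟩
    have h0 := norm_nonneg s
    have hM : 0 ≤ (1 + ‖s‖) ^ (3 / 2 : ℝ) := by positivity
    rcases le_total s.re 2 with h | h
    · calc ‖F s‖ ≤ A * (1 + ‖s‖) ^ 2 := hA s hs h
        _ ≤ Real.exp (|A| * (1 + ‖s‖) ^ (3 / 2 : ℝ)) *
            Real.exp (2 * (1 + ‖s‖) ^ (3 / 2 : ℝ)) :=
          mul_le_mul (le_exp_abs_rpow A s) (sq_le_exp_rpow s) (by positivity) (by positivity)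
        _ ≤ _ := by
          rw [← Real.exp_add, ← add_mul]
          have : (0 : ℝ) ≤ 2 * 2 ^ (3 / 2 : ℝ) := by positivity
          refine Real.exp_le_exp.mpr (mul_le_mul_of_nonneg_right ?_ hM)
          linarith [abs_nonneg B]
    · have hs0 : s ≠ 0 ∧ s ≠ 1 := by
        constructor <;> rintro rfl <;> norm_num at h
      rw [hF s (.inr hs0), completedLFunction_eq_gammaFactor_mul χ (by linarith), norm_mul,
        norm_mul]
      have hg : ‖gammaFactor χ s‖ ≤
          Real.exp (2 * 2 ^ (3 / 2 : ℝ) * (1 + ‖s‖) ^ (3 / 2 : ℝ)) := by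
        refine (norm_gammaFactor_le χ h).trans ?_
        rw [mul_assoc]
        gcongr
        exact rpow_two_add_norm_le s
      calc _ ≤ Real.exp (2 * (1 + ‖s‖) ^ (3 / 2 : ℝ)) *
            (Real.exp (2 * 2 ^ (3 / 2 : ℝ) * (1 + ‖s‖) ^ (3 / 2 : ℝ)) *
              Real.exp (|B| * (1 + ‖s‖) ^ (3 / 2 : ℝ))) := by
            gcongr
            · exact (norm_poleFactor_le q s).trans (sq_le_exp_rpow s)
            · exact (hB s h).trans (le_exp_abs_rpow B s)
        _ ≤ _ := by
          rw [← Real.exp_add, ← Real.exp_add, ← add_mul, ← add_mul]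
          refine Real.exp_le_exp.mpr (mul_le_mul_of_nonneg_right ?_ hM)
          linarith [abs_nonneg A]
  refine ⟨D * 2 ^ (3 / 2 : ℝ) + D + ‖F 0‖ + q + ‖rootNumber χ‖, fun s ↦ ?_⟩
  have h0 := norm_nonneg s
  have hM : 0 ≤ (1 + ‖s‖) ^ (3 / 2 : ℝ) := by positivity
  have hq : (0 : ℝ) ≤ q := q.cast_nonneg
  have hF0 := norm_nonneg (F 0)
  have hr0 := norm_nonneg (rootNumber χ)
  have hD2 : 0 ≤ D * 2 ^ (3 / 2 : ℝ) := by positivity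
  rcases le_or_gt (1 / 2) s.re with h | h
  · refine (hD s h).trans ?_
    gcongr
    linarith
  rcases eq_or_ne s 0 with rfl | hs
  · refine (le_exp_abs_rpow ‖F 0‖ 0).trans ?_
    rw [abs_norm]
    gcongr
    linarith
  have hs1 : s ≠ 1 := by rintro rfl; norm_num at h
  have hw : F (1 - conj s) = poleFactor q (1 - conj s) * completedLFunction χ (1 - conj s) :=
    hF _ (.inr ⟨by
      intro hc
      exact hs1 (by simpa using congrArg conj (sub_eq_zero.mp hc).symm), by simpa using hs⟩)
  have heq : ‖F s‖ = ‖(q : ℂ) ^ (1 / 2 - s)‖ * ‖rootNumber χ‖ * ‖F (1 - conj s)‖ := by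
    rw [hw, poleFactor_one_sub_conj, hF s (.inr ⟨hs, hs1⟩),
      completedLFunction_eq_mul_conj hχ (by linarith) (.inl hs)]
    simp only [norm_mul, RCLike.norm_conj]
    ring
  have hqp : ‖(q : ℂ) ^ (1 / 2 - s)‖ ≤ Real.exp (q * (1 + ‖s‖) ^ (3 / 2 : ℝ)) := by
    have hq0 : (0 : ℝ) < q := by exact_mod_cast NeZero.pos q
    rw [norm_natCast_cpow_of_pos (NeZero.pos q), Real.rpow_def_of_pos hq0, Real.exp_le_exp]
    have h1 : Real.log q ≤ q := (Real.log_le_sub_one_of_pos hq0).trans (by linarith)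
    have h2 : (1 / 2 - s).re ≤ (1 + ‖s‖) ^ (3 / 2 : ℝ) := by
      refine le_trans ?_ (one_add_norm_le_rpow s)
      have := neg_le_of_abs_le (abs_re_le_norm s)
      simp
      linarith
    exact mul_le_mul h1 h2 (by simp; linarith) hq
  have hFw : ‖F (1 - conj s)‖ ≤ Real.exp (D * 2 ^ (3 / 2 : ℝ) * (1 + ‖s‖) ^ (3 / 2 : ℝ)) := by
    refine (hD _ (by simp; linarith)).trans ?_
    rw [mul_assoc]
    have h1 := norm_sub_le 1 (conj s)
    rw [norm_one, RCLike.norm_conj] at h1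
    refine Real.exp_le_exp.mpr (mul_le_mul_of_nonneg_left ?_ hD0)
    refine le_trans ?_ (rpow_two_add_norm_le s)
    exact Real.rpow_le_rpow (by positivity) (by linarith) (by norm_num)
  have hr := le_exp_abs_rpow ‖rootNumber χ‖ s
  rw [abs_norm] at hr
  rw [heq]
  calc _ ≤ Real.exp (q * (1 + ‖s‖) ^ (3 / 2 : ℝ)) *
        Real.exp (‖rootNumber χ‖ * (1 + ‖s‖) ^ (3 / 2 : ℝ)) *
        Real.exp (D * 2 ^ (3 / 2 : ℝ) * (1 + ‖s‖) ^ (3 / 2 : ℝ)) := by gcongr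
    _ ≤ _ := by
      rw [← Real.exp_add, ← Real.exp_add, ← add_mul, ← add_mul]
      refine Real.exp_le_exp.mpr (mul_le_mul_of_nonneg_right ?_ hM)
      linarith

theorem not_forall_add_two_eq_mul {χ : DirichletCharacter ℂ q} {F : ℂ → ℂ}
    (hF : ∀ s, (q ≠ 1 ∨ s ≠ 0 ∧ s ≠ 1) → F s = poleFactor q s * completedLFunction χ s) (c : ℂ) :
    ¬ ∀ s, F (s + 2) = c * F s := by
  intro hc
  obtain ⟨a, ha⟩ := exists_gammaFactor_add_two χ
  have key : ∀ x : ℝ, 1 < x →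
      ‖LFunction χ (x + 2 : ℝ)‖ * x ≤ ‖c‖ * ‖LFunction χ x‖ * (2 * Real.pi) := by
    intro x hx
    have hre : (0 : ℝ) < (x : ℂ).re := by simp; linarith
    have hre2 : (0 : ℝ) < ((x : ℂ) + 2).re := by simp; linarith
    have hx0 : (x : ℂ) ≠ 0 ∧ (x : ℂ) ≠ 1 :=
      ⟨by exact_mod_cast (by linarith : x ≠ 0), by exact_mod_cast hx.ne'⟩
    have hx2 : (x : ℂ) + 2 ≠ 0 ∧ (x : ℂ) + 2 ≠ 1 := by
      constructor
      · exact_mod_cast (by linarith : x + 2 ≠ 0)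
      · exact_mod_cast (by linarith : x + 2 ≠ 1)
    have h := congrArg norm (hc x)
    rw [hF _ (.inr hx0), hF _ (.inr hx2), completedLFunction_eq_gammaFactor_mul χ hre,
      completedLFunction_eq_gammaFactor_mul χ hre2, ha x hre] at h
    simp only [norm_mul, norm_div, norm_real, norm_ofNat, Real.norm_eq_abs,
      abs_of_pos Real.pi_pos] at h
    have hp := norm_poleFactor_le_add_two q hx.le
    have hp0 : 0 < ‖poleFactor q x‖ := norm_pos_iff.mpr (poleFactor_ne_zero (.inr hx0))
    have hg0 : 0 < ‖gammaFactor χ x‖ := norm_pos_iff.mpr (gammaFactor_ne_zero χ hre)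
    have hxa : x ≤ ‖(x : ℂ) + a‖ := by
      have h1 := re_le_norm ((x : ℂ) + a)
      simp only [add_re, ofReal_re, natCast_re] at h1
      linarith [(a.cast_nonneg : (0 : ℝ) ≤ a)]
    have hpi := Real.pi_pos
    push_cast
    refine le_of_mul_le_mul_left (a := ‖poleFactor q x‖ * ‖gammaFactor χ x‖) ?_ (by positivity)
    calc _ ≤ ‖poleFactor q (x + 2)‖ * ‖gammaFactor χ x‖ *
          (‖LFunction χ (x + 2)‖ * ‖(x : ℂ) + a‖) := by gcongr
      _ = ‖poleFactor q (x + 2)‖ * (‖gammaFactor χ x‖ * ‖(x : ℂ) + a‖ / 2 / Real.pi *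
          ‖LFunction χ (x + 2)‖) * (2 * Real.pi) := by field_simp
      _ = _ := by rw [h]; ring
  have hlim := (tendsto_LFunction_atTop χ).norm
  rw [norm_one] at hlim
  have hlim2 : Tendsto (fun x : ℝ ↦ ‖LFunction χ (x + 2 : ℝ)‖) atTop (𝓝 1) :=
    hlim.comp (tendsto_atTop_add_const_right _ 2 tendsto_id)
  have htop := hlim2.pos_mul_atTop one_pos tendsto_id
  have hbdd := (hlim.const_mul ‖c‖).mul_const (2 * Real.pi)
  refine not_tendsto_nhds_of_tendsto_atTop
    (tendsto_atTop_mono' atTop ?_ htop) _ hbdd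
  filter_upwards [eventually_gt_atTop 1] with x hx using key x hx

end DirichletCharacter

/-- Every Dirichlet L-function of a primitive Dirichlet character has a zero `ρ` with
`1/2 ≤ Re ρ < 1`. -/
theorem exists_zero_with_re_ge_half
    {q : ℕ} [NeZero q] (χ : DirichletCharacter ℂ q) (hχ : χ.IsPrimitive) :
    ∃ ρ : ℂ, DirichletCharacter.LFunction χ ρ = 0 ∧ 1 / 2 ≤ ρ.re ∧ ρ.re < 1 := by
  by_contra! hL
  obtain ⟨F, hFd, hF, hF01, hFb⟩ := DirichletCharacter.exists_entire_completedLFunction hχ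
  obtain ⟨C, hC⟩ := DirichletCharacter.exists_norm_le_exp_rpow hχ hF hFb
  have hF0 : ∀ s, F s ≠ 0 := by
    intro s
    by_cases hs : q ≠ 1 ∨ s ≠ 0 ∧ s ≠ 1
    · rw [hF s hs]
      exact mul_ne_zero (DirichletCharacter.poleFactor_ne_zero hs)
        (DirichletCharacter.completedLFunction_ne_zero hχ
          (fun z h1 h2 h3 ↦ (hL z h3 h1).not_gt h2) hs)
    · simp only [not_or, not_not, not_and_or] at hs
      obtain ⟨hq, rfl | rfl⟩ := hs
      · exact (hF01 hq).1
      · exact (hF01 hq).2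
  obtain ⟨k, hk⟩ := exists_eq_mul_exp_of_norm_le_exp_rpow hFd hF0 hC
  refine DirichletCharacter.not_forall_add_two_eq_mul hF (exp (k * 2)) fun s ↦ ?_
  rw [hk (s + 2), hk s, mul_add, exp_add]
  ring
end
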